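/- Let φ : ℝⁿ → ℝ ∪ {+∞} be proper, lower semicontinuous and ρ-weakly convex for some ρ ≥ 0. Then φ is convex if and only if d²φ(x,v)(w) ≥ 0 for every (x,v) ∈ gph ∂φ and every w ∈ ℝⁿ. -/

import Mathlib

open scoped RealInnerProductSpace
open Filter Topology MeasureTheory Set

noncomputable section

variable {n : ℕ}

/-- Convexity of an extended-real-valued function `φ : ℝⁿ → ℝ ∪ {+∞}`. -/
def ERealConvex {F : Type*} [AddCommGroup F] [Module ℝ F] (φ : F → EReal) : Prop :=
  ∀ x y : F, ∀ a b : ℝ, 0 ≤ a → 0 ≤ b → a + b = 1 →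
    φ (a • x + b • y) ≤ (a : EReal) * φ x + (b : EReal) * φ y

/-- The shifted function `x ↦ φ(x) + (ρ/2)‖x‖²`. -/
def shiftFun (ρ : ℝ) (φ : EuclideanSpace ℝ (Fin n) → EReal) :
    EuclideanSpace ℝ (Fin n) → EReal :=
  fun x => φ x + (((ρ / 2) * ‖x‖ ^ 2 : ℝ) : EReal)

/-- The subdifferential of a `ρ`-weakly convex function. -/
def subdiff (ρ : ℝ) (φ : EuclideanSpace ℝ (Fin n) → EReal)
    (x : EuclideanSpace ℝ (Fin n)) : Set (EuclideanSpace ℝ (Fin n)) :=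
  {v | φ x ≠ ⊤ ∧
    ∀ u, φ x + ((⟪v, u - x⟫ - (ρ / 2) * ‖u - x‖ ^ 2 : ℝ) : EReal) ≤ φ u}

/-- Graph of the subdifferential mapping. -/
def gphSubdiff (ρ : ℝ) (φ : EuclideanSpace ℝ (Fin n) → EReal) :
    Set (EuclideanSpace ℝ (Fin n) × EuclideanSpace ℝ (Fin n)) :=
  {p | p.2 ∈ subdiff ρ φ p.1}

/-- The (Bouligand–Severi) tangent/contingent cone to `S` at `z`. -/
def contTangentCone {F : Type*} [NormedAddCommGroup F] [NormedSpace ℝ F]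
    (S : Set F) (z : F) : Set F :=
  {w | ∃ (t : ℕ → ℝ) (ws : ℕ → F), (∀ k, 0 < t k) ∧ Tendsto t atTop (𝓝 0) ∧
    Tendsto ws atTop (𝓝 w) ∧ ∀ k, z + t k • ws k ∈ S}

/-- Inner product of pairs in `ℝⁿ × ℝⁿ`. -/
def pairInner (p q : EuclideanSpace ℝ (Fin n) × EuclideanSpace ℝ (Fin n)) : ℝ :=
  ⟪p.1, q.1⟫ + ⟪p.2, q.2⟫

/-- The (Fréchet) regular normal cone to `S` at `z`. -/
def regNormalCone (S : Set (EuclideanSpace ℝ (Fin n) × EuclideanSpace ℝ (Fin n)))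
    (z : EuclideanSpace ℝ (Fin n) × EuclideanSpace ℝ (Fin n)) :
    Set (EuclideanSpace ℝ (Fin n) × EuclideanSpace ℝ (Fin n)) :=
  {v | ∀ ε > (0 : ℝ), ∃ δ > (0 : ℝ), ∀ u ∈ S, ‖u - z‖ < δ →
      pairInner v (u - z) ≤ ε * ‖u - z‖}

/-- The (Mordukhovich) limiting normal cone to `S` at `z`. -/
def limNormalCone (S : Set (EuclideanSpace ℝ (Fin n) × EuclideanSpace ℝ (Fin n)))
    (z : EuclideanSpace ℝ (Fin n) × EuclideanSpace ℝ (Fin n)) :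
    Set (EuclideanSpace ℝ (Fin n) × EuclideanSpace ℝ (Fin n)) :=
  {v | ∃ zs vs : ℕ → EuclideanSpace ℝ (Fin n) × EuclideanSpace ℝ (Fin n),
    (∀ k, zs k ∈ S) ∧ Tendsto zs atTop (𝓝 z) ∧ Tendsto vs atTop (𝓝 v) ∧
    ∀ k, vs k ∈ regNormalCone S (zs k)}

/-- The Moreau envelope `e_λ φ`. -/
def moreau (lam : ℝ) (φ : EuclideanSpace ℝ (Fin n) → EReal)
    (x : EuclideanSpace ℝ (Fin n)) : EReal :=
  ⨅ y, (φ y + ((‖y - x‖ ^ 2 / (2 * lam) : ℝ) : EReal))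

/-- Second-order difference quotient `Δ²_τ φ(x,v)(u)`. -/
def delta2 (φ : EuclideanSpace ℝ (Fin n) → EReal) (x v : EuclideanSpace ℝ (Fin n))
    (τ : ℝ) (u : EuclideanSpace ℝ (Fin n)) : EReal :=
  ((2 / τ ^ 2 : ℝ) : EReal) * (φ (x + τ • u) - φ x - ((τ * ⟪v, u⟫ : ℝ) : EReal))

/-- The second subderivative `d²φ(x,v)(w)`. -/
def secondSubderiv (φ : EuclideanSpace ℝ (Fin n) → EReal)
    (x v w : EuclideanSpace ℝ (Fin n)) : EReal :=
  Filter.liminf (fun p : ℝ × EuclideanSpace ℝ (Fin n) => delta2 φ x v p.1 p.2)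
    ((𝓝[>] (0 : ℝ)) ×ˢ 𝓝 w)

/-- Twice epi-differentiability of `φ` at `x` for `v`. -/
def TwiceEpiDiff (φ : EuclideanSpace ℝ (Fin n) → EReal)
    (x v : EuclideanSpace ℝ (Fin n)) : Prop :=
  ∀ w : EuclideanSpace ℝ (Fin n), ∀ τ : ℕ → ℝ, (∀ k, 0 < τ k) →
    Tendsto τ atTop (𝓝 0) →
    ∃ ws : ℕ → EuclideanSpace ℝ (Fin n), Tendsto ws atTop (𝓝 w) ∧
      Tendsto (fun k => delta2 φ x v (τ k) (ws k)) atTop (𝓝 (secondSubderiv φ x v w))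

/-- Generalized twice differentiability of `φ` at `x` for `v`. -/
def GenTwiceDiff (φ : EuclideanSpace ℝ (Fin n) → EReal)
    (x v : EuclideanSpace ℝ (Fin n)) : Prop :=
  TwiceEpiDiff φ x v ∧
    ∃ (A : EuclideanSpace ℝ (Fin n) →ₗ[ℝ] EuclideanSpace ℝ (Fin n))
      (L : Submodule ℝ (EuclideanSpace ℝ (Fin n))),
      (∀ u w, ⟪A u, w⟫ = ⟪u, A w⟫) ∧
      (∀ w ∈ L, secondSubderiv φ x v w = ((⟪w, A w⟫ : ℝ) : EReal)) ∧
      (∀ w ∉ L, secondSubderiv φ x v w = (⊤ : EReal))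

lemma wcx_limit {A B : ℝ} (h : ∀ t : ℝ, 0 < t → t ≤ 1 → 0 ≤ A + t * B) : 0 ≤ A := by
  by_contra hA
  push Not at hA
  have hB : 0 < |B| + 1 := by positivity
  have ht := h (min 1 (-A / (2 * (|B| + 1)))) (lt_min one_pos (by apply div_pos <;> linarith))
    (min_le_left _ _)
  set t := min 1 (-A / (2 * (|B| + 1))) with htdef
  have h0 : 0 < t := lt_min one_pos (by apply div_pos <;> linarith)
  have h1 : t ≤ -A / (2 * (|B| + 1)) := min_le_right _ _
  rw [le_div_iff₀ (by linarith)] at h1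
  nlinarith [le_abs_self B]

lemma wcx_coe {φ : EuclideanSpace ℝ (Fin n) → EReal} (hb : ∀ x, φ x ≠ ⊥)
    {x : EuclideanSpace ℝ (Fin n)} (hx : φ x ≠ ⊤) : φ x = ((φ x).toReal : EReal) :=
  (EReal.coe_toReal hx (hb x)).symm

/-- Weak convexity in real terms. -/
lemma wcx_wc {φ : EuclideanSpace ℝ (Fin n) → EReal} (hb : ∀ x, φ x ≠ ⊥) {ρ : ℝ}
    (hw : ERealConvex (shiftFun ρ φ)) {x y : EuclideanSpace ℝ (Fin n)} (hx : φ x ≠ ⊤)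
    (hy : φ y ≠ ⊤) {t : ℝ} (h0 : 0 ≤ t) (h1 : t ≤ 1) :
    φ (x + t • (y - x)) ≠ ⊤ ∧ (φ (x + t • (y - x))).toReal ≤
      (1 - t) * (φ x).toReal + t * (φ y).toReal + ρ / 2 * (t * (1 - t)) * ‖y - x‖ ^ 2 := by
  have h := hw x y (1 - t) t (by linarith) h0 (by ring)
  have hz : (1 - t) • x + t • y = x + t • (y - x) := by module
  rw [hz] at h
  unfold shiftFun at h
  rw [wcx_coe hb hx, wcx_coe hb hy] at h
  have hne : φ (x + t • (y - x)) ≠ ⊤ := by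
    intro htop
    rw [htop] at h
    norm_cast at h
  refine ⟨hne, ?_⟩
  rw [wcx_coe hb hne] at h
  norm_cast at h
  have e1 : ‖x + t • (y - x)‖ ^ 2 = ‖x‖ ^ 2 + 2 * t * inner ℝ x (y - x) + t ^ 2 * ‖y - x‖ ^ 2 := by
    rw [norm_add_sq_real, norm_smul, inner_smul_right, mul_pow, Real.norm_eq_abs, sq_abs]; ring
  have e2 : ‖y‖ ^ 2 = ‖x‖ ^ 2 + 2 * inner ℝ x (y - x) + ‖y - x‖ ^ 2 := by
    have : y = x + (y - x) := by abel
    conv_lhs => rw [this]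
    rw [norm_add_sq_real]
  rw [e1, e2] at h
  nlinarith [h]

/-- Any real-valued weak convexity with subgradient `v` upgrade. -/
lemma wcx_sub_upgrade {φ : EuclideanSpace ℝ (Fin n) → EReal} (hb : ∀ x, φ x ≠ ⊥) {ρ σ : ℝ}
    (hw : ERealConvex (shiftFun ρ φ)) {x v y : EuclideanSpace ℝ (Fin n)} (hx : φ x ≠ ⊤)
    (hy : φ y ≠ ⊤)
    (hv : ∀ u, φ u ≠ ⊤ → (φ x).toReal + inner ℝ v (u - x) - σ * ‖u - x‖ ^ 2 ≤ (φ u).toReal) :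
    (φ x).toReal + inner ℝ v (y - x) - ρ / 2 * ‖y - x‖ ^ 2 ≤ (φ y).toReal := by
  have := wcx_limit (A := (φ y).toReal - (φ x).toReal - inner ℝ v (y - x) + ρ / 2 * ‖y - x‖ ^ 2)
    (B := (σ - ρ / 2) * ‖y - x‖ ^ 2) (by
      intro t h0 h1
      obtain ⟨hne, hle⟩ := wcx_wc hb hw hx hy h0.le h1
      have h2 := hv _ hne
      have e : x + t • (y - x) - x = t • (y - x) := by abel
      rw [e, inner_smul_right, norm_smul, mul_pow, Real.norm_eq_abs, sq_abs] at h2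
      have h3 := h2.trans hle
      have : 0 ≤ t * ((φ y).toReal - (φ x).toReal - inner ℝ v (y - x) + ρ / 2 * ‖y - x‖ ^ 2
          + t * ((σ - ρ / 2) * ‖y - x‖ ^ 2)) := by nlinarith [h3]
      exact nonneg_of_mul_nonneg_right this h0)
  linarith

lemma wcx_quad {φ : EuclideanSpace ℝ (Fin n) → EReal} (hb : ∀ x, φ x ≠ ⊥)
    (hp : ∃ x, φ x ≠ ⊤) (hl : LowerSemicontinuous φ) {ρ : ℝ} (hρ : 0 ≤ ρ)
    (hw : ERealConvex (shiftFun ρ φ)) (z : EuclideanSpace ℝ (Fin n)) :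
    ∃ A : ℝ, ∀ y, φ y ≠ ⊤ → -A - (ρ + 1) * ‖y - z‖ ^ 2 ≤ (φ y).toReal := by
  obtain ⟨x0, hx0⟩ := hp
  obtain ⟨m, hm, hmin⟩ := LowerSemicontinuousOn.exists_isMinOn
    (s := Metric.closedBall x0 1) ⟨x0, by simp⟩ (isCompact_closedBall x0 1)
    (hl.lowerSemicontinuousOn _)
  rw [isMinOn_iff] at hmin
  have hmtop : φ m ≠ ⊤ := fun h => hx0 (top_le_iff.1 (h ▸ hmin x0 (by simp)))
  have hball : ∀ u, φ u ≠ ⊤ → ‖u - x0‖ ≤ 1 → -|(φ m).toReal| ≤ (φ u).toReal := by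
    intro u hu hd
    have := hmin u (by simpa [dist_eq_norm] using hd)
    rw [wcx_coe hb hu, wcx_coe hb hmtop, EReal.coe_le_coe_iff] at this
    linarith [neg_abs_le (φ m).toReal]
  set M := |(φ m).toReal|
  have hM : 0 ≤ M := abs_nonneg _
  set N := |(φ x0).toReal| with hN
  have hNn : 0 ≤ N := abs_nonneg _
  have hN1 : (φ x0).toReal ≤ N := le_abs_self _
  have key : ∀ y, φ y ≠ ⊤ → -(M + N + (M + N) ^ 2) - (ρ + 1) / 2 * ‖y - x0‖ ^ 2 ≤ (φ y).toReal := by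
    intro y hy
    rcases le_or_gt ‖y - x0‖ 1 with h | h
    · have := hball y hy h
      have : 0 ≤ (ρ + 1) / 2 * ‖y - x0‖ ^ 2 := by positivity
      nlinarith [sq_nonneg (M + N)]
    · set r := ‖y - x0‖ with hr
      have hr0 : 0 < r := by linarith
      obtain ⟨hne, hle⟩ := wcx_wc hb hw hx0 hy (t := r⁻¹) (by positivity) (inv_le_one_of_one_le₀ h.le)
      have h2 := hball _ hne (by
        rw [add_sub_cancel_left, norm_smul, norm_inv, Real.norm_of_nonneg hr0.le, ← hr,
          inv_mul_cancel₀ hr0.ne'])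
      have h3 := h2.trans hle
      rw [← hr] at h3
      have h4 := mul_le_mul_of_nonneg_left h3 hr0.le
      have e : r * ((1 - r⁻¹) * (φ x0).toReal + r⁻¹ * (φ y).toReal + ρ / 2 * (r⁻¹ * (1 - r⁻¹)) * r ^ 2)
          = (r - 1) * (φ x0).toReal + (φ y).toReal + ρ / 2 * (r - 1) * r := by
        field_simp
      rw [e] at h4
      have h5 : (r - 1) * (φ x0).toReal ≤ (r - 1) * N := mul_le_mul_of_nonneg_left hN1 (by linarith)
      have h6 : 0 ≤ ρ * r := by positivity
      nlinarith [sq_nonneg (M + N - r), sq_nonneg (M+N)]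
  refine ⟨M + N + (M + N) ^ 2 + (ρ + 1) * ‖z - x0‖ ^ 2, fun y hy => ?_⟩
  have h := key y hy
  have h2 : ‖y - x0‖ ^ 2 ≤ 2 * ‖y - z‖ ^ 2 + 2 * ‖z - x0‖ ^ 2 := by
    have : ‖y - x0‖ ≤ ‖y - z‖ + ‖z - x0‖ := norm_sub_le_norm_sub_add_norm_sub _ _ _
    nlinarith [norm_nonneg (y - x0), sq_nonneg (‖y - z‖ - ‖z - x0‖)]
  nlinarith

lemma wcx_prox {φ : EuclideanSpace ℝ (Fin n) → EReal} (hb : ∀ x, φ x ≠ ⊥)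
    (hp : ∃ x, φ x ≠ ⊤) (hl : LowerSemicontinuous φ) {ρ : ℝ} (hρ : 0 ≤ ρ)
    (hw : ERealConvex (shiftFun ρ φ)) {c : ℝ} (hc : 2 * ρ + 4 ≤ c)
    (z : EuclideanSpace ℝ (Fin n)) :
    ∃ p, φ p ≠ ⊤ ∧ ∀ y, φ y ≠ ⊤ →
      (φ p).toReal + c / 2 * ‖p - z‖ ^ 2 ≤ (φ y).toReal + c / 2 * ‖y - z‖ ^ 2 := by
  obtain ⟨A, hA⟩ := wcx_quad hb hp hl hρ hw z
  obtain ⟨x0, hx0⟩ := hp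
  set e0 := (φ x0).toReal + c / 2 * ‖x0 - z‖ ^ 2 with he0
  set R := |e0 + A| + 1 + ‖x0 - z‖ with hR
  have hR1 : 1 ≤ R := by
    have := abs_nonneg (e0 + A); have := norm_nonneg (x0 - z); linarith
  have hlsc : LowerSemicontinuous (fun y => φ y + ((c / 2 * ‖y - z‖ ^ 2 : ℝ) : EReal)) := by
    apply hl.add'
    · apply Continuous.lowerSemicontinuous
      exact continuous_coe_real_ereal.comp (by fun_prop)
    · intro x
      exact EReal.continuousAt_add (Or.inr (EReal.coe_ne_bot _)) (Or.inl (hb x))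
  have hx0m : x0 ∈ Metric.closedBall z R := by
    rw [Metric.mem_closedBall, dist_eq_norm, hR]
    have := abs_nonneg (e0 + A); linarith
  obtain ⟨p, hpm, hmin⟩ := LowerSemicontinuousOn.exists_isMinOn
    (s := Metric.closedBall z R) ⟨x0, hx0m⟩ (isCompact_closedBall z R)
    (hlsc.lowerSemicontinuousOn _)
  rw [isMinOn_iff] at hmin
  have hpt : φ p ≠ ⊤ := by
    intro h
    have := hmin x0 hx0m
    rw [h, EReal.top_add_coe, wcx_coe hb hx0, ← EReal.coe_add] at this
    exact EReal.coe_ne_top _ (top_le_iff.1 this)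
  have hin : ∀ y, φ y ≠ ⊤ → y ∈ Metric.closedBall z R →
      (φ p).toReal + c / 2 * ‖p - z‖ ^ 2 ≤ (φ y).toReal + c / 2 * ‖y - z‖ ^ 2 := by
    intro y hy hyR
    have := hmin y hyR
    rw [wcx_coe hb hpt, wcx_coe hb hy] at this
    exact_mod_cast this
  refine ⟨p, hpt, fun y hy => ?_⟩
  by_cases hyR : y ∈ Metric.closedBall z R
  · exact hin y hy hyR
  · refine (hin x0 hx0 hx0m).trans ?_
    rw [Metric.mem_closedBall, dist_eq_norm, not_le] at hyR
    have h1 := hA y hy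
    have h2 : e0 + A ≤ R := by
      have := le_abs_self (e0 + A); have := norm_nonneg (x0 - z); linarith
    have h3 : R ≤ ‖y - z‖ ^ 2 := by nlinarith
    have h4 : 0 ≤ (c / 2 - (ρ + 1) - 1) * ‖y - z‖ ^ 2 :=
      mul_nonneg (by linarith) (sq_nonneg _)
    nlinarith

/-- One-dimensional convexity criterion. -/
lemma wcx_one_dim (G : ℝ → ℝ) (hu : UpperSemicontinuous G)
    (hG : ∀ t, ∃ v : ℝ, ∀ ε > 0, ∃ δ > 0, ∀ s, |s - t| < δ →
      G t + v * (s - t) - ε * (s - t) ^ 2 ≤ G s) (T : ℝ) (h0 : 0 ≤ T) (h1 : T ≤ 1) :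
    G T ≤ (1 - T) * G 0 + T * G 1 := by
  by_contra hcon
  push Not at hcon
  set η := G T - ((1 - T) * G 0 + T * G 1) with hη
  have hηp : 0 < η := by linarith
  set q : ℝ → ℝ := fun t => -((1 - t) * G 0 + t * G 1) + η * (t ^ 2 - t) with hq
  have hus : UpperSemicontinuous (fun t => G t + q t) := by
    apply hu.add
    apply Continuous.upperSemicontinuous
    simp only [hq]; fun_prop
  obtain ⟨t, ht, hmax⟩ := UpperSemicontinuousOn.exists_isMaxOn (s := Icc (0:ℝ) 1)
    ⟨0, by simp⟩ isCompact_Icc (hus.upperSemicontinuousOn _)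
  rw [isMaxOn_iff] at hmax
  have hpos : 0 < G t + q t := by
    refine lt_of_lt_of_le ?_ (hmax T ⟨h0, h1⟩)
    simp only [hq]
    nlinarith [sq_nonneg (T - 1/2)]
  have ht0 : 0 < t := by
    rcases ht.1.lt_or_eq with h | h
    · exact h
    · rw [← h] at hpos; simp [hq] at hpos
  have ht1 : t < 1 := by
    rcases ht.2.lt_or_eq with h | h
    · exact h
    · rw [h] at hpos; simp [hq] at hpos
  obtain ⟨v, hv⟩ := hG t
  obtain ⟨δ, hδ, hd⟩ := hv (η / 2) (by linarith)
  set h := min (δ / 2) (min t (1 - t)) with hh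
  have hhp : 0 < h := lt_min (by linarith) (lt_min ht0 (by linarith))
  have hh1 : h ≤ δ / 2 := min_le_left _ _
  have hh2 : h ≤ t := (min_le_right _ _).trans (min_le_left _ _)
  have hh3 : h ≤ 1 - t := (min_le_right _ _).trans (min_le_right _ _)
  have a1 := hd (t + h) (by rw [add_sub_cancel_left, abs_of_pos hhp]; linarith)
  have a2 := hd (t - h) (by rw [abs_sub_comm, sub_sub_cancel, abs_of_pos hhp]; linarith)
  have b1 := hmax (t + h) ⟨by linarith, by linarith⟩
  have b2 := hmax (t - h) ⟨by linarith, by linarith⟩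
  simp only [hq] at b1 b2
  have : 0 < η * h ^ 2 := by positivity
  nlinarith

/-- Nonnegative second subderivative gives a local second-order lower bound. -/
lemma wcx_lower {φ : EuclideanSpace ℝ (Fin n) → EReal} (hb : ∀ x, φ x ≠ ⊥)
    {x v : EuclideanSpace ℝ (Fin n)} (hx : φ x ≠ ⊤)
    (h : ∀ w, 0 ≤ secondSubderiv φ x v w) {ε : ℝ} (hε : 0 < ε) :
    ∃ δ > 0, ∀ y, φ y ≠ ⊤ → ‖y - x‖ < δ →
      (φ x).toReal + inner ℝ v (y - x) - ε * ‖y - x‖ ^ 2 ≤ (φ y).toReal := by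
  have hev : ∀ w ∈ Metric.sphere (0 : EuclideanSpace ℝ (Fin n)) 1,
      {p : ℝ × EuclideanSpace ℝ (Fin n) | ((-(2 * ε) : ℝ) : EReal) < delta2 φ x v p.1 p.2} ∈
        (𝓝[>] (0 : ℝ)) ×ˢ 𝓝 w := by
    intro w _
    have : ((-(2 * ε) : ℝ) : EReal) < secondSubderiv φ x v w :=
      lt_of_lt_of_le (by exact_mod_cast (by linarith : -(2 * ε) < 0)) (h w)
    exact eventually_lt_of_lt_liminf this
  have hK : ∀ᶠ p in (𝓝[>] (0 : ℝ)) ×ˢ 𝓝ˢ (Metric.sphere (0 : EuclideanSpace ℝ (Fin n)) 1),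
      ((-(2 * ε) : ℝ) : EReal) < delta2 φ x v p.1 p.2 := by
    rw [(isCompact_sphere _ _).prod_nhdsSet_eq_biSup]
    simp only [eventually_iSup]
    exact hev
  have hK2 := hK.curry.mono fun _ h ↦ h.self_of_nhdsSet
  rw [eventually_nhdsWithin_iff, Metric.eventually_nhds_iff] at hK2
  obtain ⟨δ, hδ, hd⟩ := hK2
  refine ⟨δ, hδ, fun y hy hyd => ?_⟩
  rcases eq_or_ne y x with rfl | hne
  · simp
  have hr : 0 < ‖y - x‖ := norm_pos_iff.2 (sub_ne_zero.2 hne)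
  set r := ‖y - x‖ with hrdef
  have := hd (y := r) (by simpa [abs_of_pos hr] using hyd) hr (r⁻¹ • (y - x)) (by
    simp [norm_smul, ← hrdef, abs_of_pos hr, hr.ne'])
  unfold delta2 at this
  rw [smul_smul, mul_inv_cancel₀ hr.ne', one_smul, add_sub_cancel, inner_smul_right,
    ← mul_assoc, mul_inv_cancel₀ hr.ne', one_mul, wcx_coe hb hx, wcx_coe hb hy] at this
  norm_cast at this
  have e : 2 / r ^ 2 * ((φ y).toReal - (φ x).toReal - inner ℝ v (y - x)) =
    (2 * ((φ y).toReal - (φ x).toReal - inner ℝ v (y - x))) / r ^ 2 := by ring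
  rw [e, lt_div_iff₀ (by positivity)] at this
  nlinarith

lemma wcx_forward {φ : EuclideanSpace ℝ (Fin n) → EReal} (hb : ∀ x, φ x ≠ ⊥) {ρ : ℝ}
    (hc : ERealConvex φ) {x v : EuclideanSpace ℝ (Fin n)} (hv : v ∈ subdiff ρ φ x)
    (w : EuclideanSpace ℝ (Fin n)) : 0 ≤ secondSubderiv φ x v w := by
  obtain ⟨hx, hv⟩ := hv
  have hc0 : ERealConvex (shiftFun 0 φ) := by
    have : shiftFun 0 φ = φ := by funext y; simp [shiftFun]
    rwa [this]
  unfold secondSubderiv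
  refine le_liminf_of_le (by isBoundedDefault) ?_
  have : ∀ᶠ p : ℝ × EuclideanSpace ℝ (Fin n) in (𝓝[>] (0 : ℝ)) ×ˢ 𝓝 w, 0 < p.1 :=
    tendsto_fst.eventually (eventually_mem_nhdsWithin)
  filter_upwards [this] with p hp
  unfold delta2
  apply mul_nonneg
  · exact_mod_cast (by positivity : (0:ℝ) ≤ 2 / p.1 ^ 2)
  · by_cases hy : φ (x + p.1 • p.2) = ⊤
    · rw [hy, wcx_coe hb hx, EReal.top_sub_coe, EReal.top_sub_coe]
      exact le_top
    · have := wcx_sub_upgrade (σ := ρ / 2) hb hc0 hx hy (v := v) (by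
        intro u hu
        have := hv u
        rw [wcx_coe hb hx, wcx_coe hb hu] at this
        norm_cast at this
        linarith)
      rw [add_sub_cancel_left, inner_smul_right] at this
      rw [wcx_coe hb hx, wcx_coe hb hy]
      norm_cast
      linarith

lemma wcx_prox_sub {φ : EuclideanSpace ℝ (Fin n) → EReal} (hb : ∀ x, φ x ≠ ⊥) {ρ c : ℝ}
    (hw : ERealConvex (shiftFun ρ φ)) {p z y : EuclideanSpace ℝ (Fin n)} (hp : φ p ≠ ⊤)
    (hm : ∀ y, φ y ≠ ⊤ →
      (φ p).toReal + c / 2 * ‖p - z‖ ^ 2 ≤ (φ y).toReal + c / 2 * ‖y - z‖ ^ 2)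
    (hy : φ y ≠ ⊤) :
    (φ p).toReal + inner ℝ (c • (z - p)) (y - p) - ρ / 2 * ‖y - p‖ ^ 2 ≤ (φ y).toReal := by
  refine wcx_sub_upgrade (σ := c / 2) hb hw hp hy fun u hu => ?_
  have h := hm u hu
  have e : ‖u - z‖ ^ 2 = ‖p - z‖ ^ 2 - 2 * inner ℝ (z - p) (u - p) + ‖u - p‖ ^ 2 := by
    have : u - z = (u - p) - (z - p) := by abel
    rw [this, norm_sub_sq_real, real_inner_comm (z - p), norm_sub_rev p z]; ring
  rw [e] at h
  rw [real_inner_smul_left]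
  linarith

lemma wcx_lip {φ : EuclideanSpace ℝ (Fin n) → EReal} (hb : ∀ x, φ x ≠ ⊥) {ρ c : ℝ}
    (hρ : 0 ≤ ρ) (hc : 2 * ρ + 4 ≤ c)
    (hw : ERealConvex (shiftFun ρ φ)) {p z p' z' : EuclideanSpace ℝ (Fin n)} (hp : φ p ≠ ⊤)
    (hm : ∀ y, φ y ≠ ⊤ →
      (φ p).toReal + c / 2 * ‖p - z‖ ^ 2 ≤ (φ y).toReal + c / 2 * ‖y - z‖ ^ 2)
    (hp' : φ p' ≠ ⊤)
    (hm' : ∀ y, φ y ≠ ⊤ →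
      (φ p').toReal + c / 2 * ‖p' - z'‖ ^ 2 ≤ (φ y).toReal + c / 2 * ‖y - z'‖ ^ 2) :
    ‖p' - p‖ ≤ 2 * ‖z' - z‖ := by
  have h1 := wcx_prox_sub hb hw hp hm hp'
  have h2 := wcx_prox_sub hb hw hp' hm' hp
  rw [real_inner_smul_left] at h1 h2
  have e : inner ℝ (z' - p') (p - p') =
      ‖p' - p‖ ^ 2 - inner ℝ (z' - z) (p' - p) - inner ℝ (z - p) (p' - p) := by
    rw [← real_inner_self_eq_norm_sq]
    have a1 : p - p' = -(p' - p) := by abel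
    have a2 : z' - p' = (z' - z) + (z - p) - (p' - p) := by abel
    rw [a1, a2, inner_neg_right, inner_sub_left, inner_add_left]; ring
  rw [e, norm_sub_rev p p'] at h2
  have h3 := real_inner_le_norm (z' - z) (p' - p)
  have h4 : (c - ρ) * ‖p' - p‖ ^ 2 ≤ c * (‖z' - z‖ * ‖p' - p‖) := by
    have := mul_le_mul_of_nonneg_left h3 (by linarith : 0 ≤ c)
    nlinarith
  by_contra hcon
  push Not at hcon
  have hpos : 0 < ‖p' - p‖ := lt_of_le_of_lt (by positivity) hcon
  have h5 : (c - ρ) * ‖p' - p‖ ≤ c * ‖z' - z‖ := by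
    apply le_of_mul_le_mul_right _ hpos
    nlinarith
  nlinarith [norm_nonneg (z' - z)]

lemma wcx_backward {φ : EuclideanSpace ℝ (Fin n) → EReal} (hb : ∀ x, φ x ≠ ⊥)
    (hproper : ∃ x, φ x ≠ ⊤) (hl : LowerSemicontinuous φ) {ρ : ℝ} (hρ : 0 ≤ ρ)
    (hw : ERealConvex (shiftFun ρ φ))
    (h : ∀ x v : EuclideanSpace ℝ (Fin n), (x, v) ∈ gphSubdiff ρ φ →
        ∀ w : EuclideanSpace ℝ (Fin n), 0 ≤ secondSubderiv φ x v w)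
    {c : ℝ} (hc : 2 * ρ + 4 ≤ c) {x y : EuclideanSpace ℝ (Fin n)} (hx : φ x ≠ ⊤) (hy : φ y ≠ ⊤)
    {T : ℝ} (h0 : 0 ≤ T) (h1 : T ≤ 1) :
    ∃ p, φ p ≠ ⊤ ∧ (φ p).toReal + c / 2 * ‖p - (x + T • (y - x))‖ ^ 2 ≤
      (1 - T) * (φ x).toReal + T * (φ y).toReal := by
  choose P hP hm using wcx_prox hb hproper hl hρ hw hc
  set e : EuclideanSpace ℝ (Fin n) → ℝ := fun z => (φ (P z)).toReal + c / 2 * ‖P z - z‖ ^ 2 with he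
  have hupper : UpperSemicontinuous e := by
    intro z0 b hb'
    have hcont : Continuous (fun z => (φ (P z0)).toReal + c / 2 * ‖P z0 - z‖ ^ 2) := by fun_prop
    filter_upwards [hcont.continuousAt.eventually_lt_const hb'] with z hz
    exact (hm z _ (hP z0)).trans_lt hz
  have hlow : ∀ z, ∃ v : EuclideanSpace ℝ (Fin n), ∀ ε > 0, ∃ δ > 0, ∀ z', ‖z' - z‖ < δ →
      e z + inner ℝ v (z' - z) - ε * ‖z' - z‖ ^ 2 ≤ e z' := by
    intro z
    refine ⟨c • (z - P z), fun ε hε => ?_⟩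
    have hg : (P z, c • (z - P z)) ∈ gphSubdiff ρ φ := by
      refine ⟨hP z, fun u => ?_⟩
      by_cases hu : φ u = ⊤
      · simp [hu]
      have := wcx_prox_sub hb hw (hP z) (hm z) hu
      dsimp only
      rw [wcx_coe hb (hP z), wcx_coe hb hu]
      norm_cast
      linarith
    obtain ⟨δ, hδ, hd⟩ := wcx_lower hb (hP z) (h _ _ hg) (ε := ε / 4) (by linarith)
    refine ⟨δ / 2, by linarith, fun z' hz' => ?_⟩
    have hL := wcx_lip hb hρ hc hw (hP z) (hm z) (hP z') (hm z')
    have h2 := hd (P z') (hP z') (by linarith)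
    have hsq : ‖P z' - P z‖ ^ 2 ≤ 4 * ‖z' - z‖ ^ 2 := by
      nlinarith [norm_nonneg (P z' - P z)]
    rw [real_inner_smul_left] at h2 ⊢
    have hid : ‖P z' - z'‖ ^ 2 = ‖P z - z‖ ^ 2 + 2 * inner ℝ (z - P z) (z' - z)
        - 2 * inner ℝ (z - P z) (P z' - P z) + ‖(z' - z) - (P z' - P z)‖ ^ 2 := by
      have a : P z' - z' = -((z - P z) + ((z' - z) - (P z' - P z))) := by abel
      rw [a, norm_neg, norm_add_sq_real, inner_sub_right, norm_sub_rev (P z) z]; ring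
    simp only [he]
    rw [hid]
    have hc0 : 0 ≤ c / 2 * ‖(z' - z) - (P z' - P z)‖ ^ 2 := by
      have : 0 ≤ c := by linarith
      positivity
    nlinarith
  have hline : Continuous (fun t : ℝ => x + t • (y - x)) := by fun_prop
  have hone := wcx_one_dim (fun t => e (x + t • (y - x))) (fun t b hb' => hline.continuousAt.eventually (hupper (x + t • (y - x)) b hb')) (by
    intro t
    obtain ⟨v, hv⟩ := hlow (x + t • (y - x))
    refine ⟨inner ℝ v (y - x), fun ε hε => ?_⟩
    set K := ‖y - x‖ ^ 2 + 1 with hK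
    have hKp : 0 < K := by positivity
    obtain ⟨δ, hδ, hd⟩ := hv (ε / K) (by positivity)
    refine ⟨δ / K, by positivity, fun s hs => ?_⟩
    have ed : x + s • (y - x) - (x + t • (y - x)) = (s - t) • (y - x) := by module
    have hle : ‖y - x‖ ≤ K := by nlinarith [sq_nonneg (‖y - x‖ - 1)]
    have := hd (x + s • (y - x)) (by
      rw [ed, norm_smul, Real.norm_eq_abs]
      rw [lt_div_iff₀ hKp] at hs
      exact (mul_le_mul_of_nonneg_left hle (abs_nonneg _)).trans_lt hs)
    rw [ed, inner_smul_right, norm_smul, mul_pow, Real.norm_eq_abs, sq_abs] at this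
    have hq : ε / K * ((s - t) ^ 2 * ‖y - x‖ ^ 2) ≤ ε * (s - t) ^ 2 := by
      rw [div_mul_eq_mul_div, div_le_iff₀ hKp]
      have : 0 ≤ ε * (s - t) ^ 2 := by positivity
      nlinarith
    linarith) T h0 h1
  refine ⟨P (x + T • (y - x)), hP _, hone.trans ?_⟩
  have ex : e x ≤ (φ x).toReal := by simpa using hm x x hx
  have ey : e y ≤ (φ y).toReal := by simpa using hm y y hy
  simp only [zero_smul, add_zero, one_smul, add_sub_cancel]
  exact add_le_add (mul_le_mul_of_nonneg_left ex (by linarith)) (mul_le_mul_of_nonneg_left ey h0)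

lemma wcx_convex {φ : EuclideanSpace ℝ (Fin n) → EReal} (hb : ∀ x, φ x ≠ ⊥)
    (hproper : ∃ x, φ x ≠ ⊤) (hl : LowerSemicontinuous φ) {ρ : ℝ} (hρ : 0 ≤ ρ)
    (hw : ERealConvex (shiftFun ρ φ))
    (h : ∀ x v : EuclideanSpace ℝ (Fin n), (x, v) ∈ gphSubdiff ρ φ →
        ∀ w : EuclideanSpace ℝ (Fin n), 0 ≤ secondSubderiv φ x v w) : ERealConvex φ := by
  intro x y a b ha hb0 hab
  rcases ha.eq_or_lt with rfl | ha
  · have : b = 1 := by linarith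
    simp [this]
  rcases hb0.eq_or_lt with rfl | hb0
  · have : a = 1 := by linarith
    simp [this]
  have hnb : ∀ (r : ℝ) (u : EuclideanSpace ℝ (Fin n)), 0 < r → (r : EReal) * φ u ≠ ⊥ := by
    intro r u hr
    by_cases hu : φ u = ⊤
    · rw [hu, EReal.coe_mul_top_of_pos hr]; simp
    · rw [wcx_coe hb hu, ← EReal.coe_mul]; exact EReal.coe_ne_bot _
  by_cases hx : φ x = ⊤
  · rw [hx, EReal.coe_mul_top_of_pos ha, EReal.top_add_of_ne_bot (hnb b y hb0)]
    exact le_top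
  by_cases hy : φ y = ⊤
  · rw [hy, EReal.coe_mul_top_of_pos hb0, EReal.add_top_of_ne_bot (hnb a x ha)]
    exact le_top
  have hz : a • x + b • y = x + b • (y - x) := by
    have : a = 1 - b := by linarith
    rw [this]; module
  rw [hz]
  set z := x + b • (y - x) with hzdef
  set C := (1 - b) * (φ x).toReal + b * (φ y).toReal with hC
  have hrhs : (a : EReal) * φ x + (b : EReal) * φ y = (C : EReal) := by
    have : a = 1 - b := by linarith
    rw [wcx_coe hb hx, wcx_coe hb hy, hC, this]
    norm_cast
  rw [hrhs]
  by_contra hcon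
  push Not at hcon
  have hev := hl z (C : EReal) hcon
  rw [Metric.eventually_nhds_iff] at hev
  obtain ⟨δ, hδ, hd⟩ := hev
  obtain ⟨A, hA⟩ := wcx_quad hb hproper hl hρ hw z
  set S := (|C + A| + 1) / δ ^ 2 with hS
  have hSp : 0 < S := by positivity
  obtain ⟨p, hp, hple⟩ := wcx_backward hb hproper hl hρ hw h (c := 2 * ρ + 4 + 2 * S) (by linarith)
    hx hy hb0.le (by linarith : b ≤ 1)
  rw [← hzdef] at hple
  have hAp := hA p hp
  have hclose : ‖p - z‖ < δ := by
    by_contra hge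
    push Not at hge
    have h1 : δ ^ 2 ≤ ‖p - z‖ ^ 2 := by gcongr
    have h2 : S * δ ^ 2 = |C + A| + 1 := by rw [hS]; field_simp
    have h3 : S * δ ^ 2 ≤ S * ‖p - z‖ ^ 2 := by gcongr
    nlinarith [le_abs_self (C + A), sq_nonneg ‖p - z‖]
  have h5 : (C : EReal) < φ p := hd (y := p) (by rwa [dist_eq_norm])
  rw [wcx_coe hb hp, EReal.coe_lt_coe_iff] at h5
  have : 0 ≤ (2 * ρ + 4 + 2 * S) / 2 * ‖p - z‖ ^ 2 := by positivity
  linarith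

/-- a weakly convex function is convex iff its second subderivatives
are nonnegative at all points of the graph of its subdifferential. -/
theorem statement8 (n : ℕ) (φ : EuclideanSpace ℝ (Fin n) → EReal)
    (hnotbot : ∀ x, φ x ≠ ⊥) (hproper : ∃ x, φ x ≠ ⊤)
    (hlsc : LowerSemicontinuous φ)
    (ρ : ℝ) (hρ : 0 ≤ ρ) (hweak : ERealConvex (shiftFun ρ φ)) :
    ERealConvex φ ↔
      ∀ x v : EuclideanSpace ℝ (Fin n), (x, v) ∈ gphSubdiff ρ φ →
        ∀ w : EuclideanSpace ℝ (Fin n), 0 ≤ secondSubderiv φ x v w := by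
  constructor
  · intro hc x v hv w
    exact wcx_forward hnotbot hc hv w
  · intro h
    exact wcx_convex hnotbot hproper hlsc hρ hweak h

end
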